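/- arXiv:1202.2071 — 2 statements merged into one kernel-verified Lean document; each statement's English description precedes it below -/
import Mathlib

section
/- Let u : ℝ → ℝ be twice continuously differentiable and 1-periodic. Define E(u) = (1/2)∫_{-1/2}^{1/2} u'(x)² dx and R(u) = -∫_{-1/2}^{1/2} (u''(x)² + u'(x)³) dx. Then R(u) ≤ (3/4^{4/3}) (∫_{-1/2}^{1/2} u'(x)² dx)^{5/3}, i.e. R(u) ≤ (3/2) E(u)^{5/3}. -/
open MeasureTheory intervalIntegral

/-- Cauchy–Schwarz for interval integrals of continuous functions. -/
theorem sq_integral_mul_le {f g : ℝ → ℝ} (hf : Continuous f) (hg : Continuous g) {a b : ℝ}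
    (hab : a ≤ b) :
    (∫ x in a..b, f x * g x) ^ 2 ≤ (∫ x in a..b, f x ^ 2) * ∫ x in a..b, g x ^ 2 := by
  have h (t : ℝ) : 0 ≤ (∫ x in a..b, f x ^ 2) * (t * t) + (-2 * ∫ x in a..b, f x * g x) * t +
      ∫ x in a..b, g x ^ 2 := by
    have hexp : ∫ x in a..b, (f x * t - g x) ^ 2 =
        (∫ x in a..b, f x ^ 2) * (t * t) + (-2 * ∫ x in a..b, f x * g x) * t +
          ∫ x in a..b, g x ^ 2 := by
      have hff : IntervalIntegrable (fun x ↦ f x ^ 2 * (t * t)) volume a b :=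
        Continuous.intervalIntegrable (by fun_prop) _ _
      have hfg : IntervalIntegrable (fun x ↦ f x * g x * (-2 * t)) volume a b :=
        Continuous.intervalIntegrable (by fun_prop) _ _
      have hgg : IntervalIntegrable (fun x ↦ g x ^ 2) volume a b :=
        Continuous.intervalIntegrable (by fun_prop) _ _
      calc ∫ x in a..b, (f x * t - g x) ^ 2
          = ∫ x in a..b, (f x ^ 2 * (t * t) + f x * g x * (-2 * t) + g x ^ 2) := by
            congr 1; ext x; ring
        _ = _ := by
            rw [integral_add (hff.add hfg) hgg, integral_add hff hfg,
              intervalIntegral.integral_mul_const, intervalIntegral.integral_mul_const]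
            ring
    rw [← hexp]
    exact intervalIntegral.integral_nonneg hab fun x _ ↦ sq_nonneg _
  have hd := discrim_le_zero h
  rw [discrim] at hd
  linarith

/-- A `C¹` function with equal values at the endpoints of an interval, and a zero in between,
is bounded there by `∫ |v v'|`. -/
theorem sq_le_integral_abs_mul_deriv {v : ℝ → ℝ} (hv : ContDiff ℝ 1 v) {a b c : ℝ}
    (hc : c ∈ Set.Icc a b) (hzero : v c = 0) (hends : v a = v b) :
    v b ^ 2 ≤ ∫ x in a..b, |v x| * |deriv v x| := by
  have hv' : Continuous (deriv v) := hv.continuous_deriv le_rfl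
  have hvc : Continuous v := hv.continuous
  have hint (p q : ℝ) : IntervalIntegrable (fun x ↦ 2 * v x * deriv v x) volume p q :=
    Continuous.intervalIntegrable (by fun_prop) _ _
  have hftc (p q : ℝ) : ∫ x in p..q, 2 * v x * deriv v x = v q ^ 2 - v p ^ 2 := by
    refine integral_eq_sub_of_hasDerivAt (f := fun x ↦ v x ^ 2) (fun x _ ↦ ?_) (hint p q)
    simpa using ((hv.differentiable one_ne_zero) x).hasDerivAt.fun_pow 2
  have habs {p q : ℝ} (hpq : p ≤ q) :
      |v q ^ 2 - v p ^ 2| ≤ 2 * ∫ x in p..q, |v x| * |deriv v x| := by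
    rw [← hftc, ← intervalIntegral.integral_const_mul]
    refine (abs_integral_le_integral_abs hpq).trans_eq ?_
    congr 1; ext x
    rw [abs_mul, abs_mul, abs_two, mul_assoc]
  have hleft := (neg_le_abs _).trans (habs hc.1)
  have hright := (le_abs_self _).trans (habs hc.2)
  have hadd := integral_add_adjacent_intervals (μ := volume) (a := a) (b := c) (c := b)
    (f := fun x ↦ |v x| * |deriv v x|)
    (Continuous.intervalIntegrable (by fun_prop) _ _)
    (Continuous.intervalIntegrable (by fun_prop) _ _)
  rw [hzero, hends] at hleft
  rw [hzero] at hright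
  linarith

/-- The sharp Agmon-type inequality for the derivative of a `1`-periodic function. -/
theorem deriv_pow_four_le {u : ℝ → ℝ} (hu : ContDiff ℝ 2 u) (hper : Function.Periodic u 1)
    (x : ℝ) :
    deriv u x ^ 4 ≤ (∫ y in (-(1:ℝ)/2)..(1/2), (deriv u y) ^ 2) *
      ∫ y in (-(1:ℝ)/2)..(1/2), (deriv (deriv u) y) ^ 2 := by
  have hv : ContDiff ℝ 1 (deriv u) := hu.deriv'
  have hv' : Continuous (deriv (deriv u)) := hv.continuous_deriv le_rfl
  have hvc : Continuous (deriv u) := hv.continuous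
  have hderiv {f : ℝ → ℝ} (hf : Function.Periodic f 1) : Function.Periodic (deriv f) 1 := by
    intro y
    rw [← deriv_comp_add_const, hf.funext]
  have hvper := hderiv hper
  have hv'per := hderiv hvper
  obtain ⟨c, hc, hzero⟩ := exists_deriv_eq_zero (sub_one_lt x) hu.continuous.continuousOn
    (hper.sub_eq x)
  have hsq := sq_le_integral_abs_mul_deriv hv (Set.Ioo_subset_Icc_self hc) hzero
    (hvper.sub_eq x)
  have hshift : ∫ y in (x - 1)..x, |deriv u y| * |deriv (deriv u) y| =
      ∫ y in (-(1:ℝ)/2)..(1/2), |deriv u y| * |deriv (deriv u) y| := by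
    have hprod : Function.Periodic (fun y ↦ |deriv u y| * |deriv (deriv u) y|) 1 := by
      intro y
      simp only [hvper y, hv'per y]
    have h := hprod.intervalIntegral_add_eq (x - 1) (-(1:ℝ)/2)
    rwa [sub_add_cancel, show -(1:ℝ)/2 + 1 = 1/2 by norm_num] at h
  rw [hshift] at hsq
  have hcs := sq_integral_mul_le hvc.abs hv'.abs (show -(1:ℝ)/2 ≤ 1/2 by norm_num)
  simp only [sq_abs] at hcs
  calc deriv u x ^ 4 = (deriv u x ^ 2) ^ 2 := by ring
    _ ≤ _ := (pow_le_pow_left₀ (sq_nonneg _) hsq 2).trans hcs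

/-- Young's inequality with exponents `4` and `4/3`, in the form optimizing over `D`. -/
theorem rpow_mul_sub_le {I D : ℝ} (hI : 0 ≤ I) (hD : 0 ≤ D) :
    (I * D) ^ ((1:ℝ)/4) * I - D ≤ 3 / 4 ^ ((4:ℝ)/3) * I ^ ((5:ℝ)/3) := by
  obtain ⟨i, hi, rfl⟩ : ∃ i : ℝ, 0 ≤ i ∧ i ^ 12 = I :=
    ⟨I ^ ((1:ℝ)/12), by positivity, by rw [← Real.rpow_mul_natCast hI]; norm_num⟩
  obtain ⟨s, hs, rfl⟩ : ∃ s : ℝ, 0 ≤ s ∧ s ^ 4 = D :=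
    ⟨D ^ ((1:ℝ)/4), by positivity, by rw [← Real.rpow_mul_natCast hD]; norm_num⟩
  obtain ⟨c, hc, hc3⟩ : ∃ c : ℝ, 0 < c ∧ c ^ 3 = 4 :=
    ⟨4 ^ ((1:ℝ)/3), by positivity, by rw [← Real.rpow_mul_natCast (by norm_num)]; norm_num⟩
  have h1 : (i ^ 12 * s ^ 4) ^ ((1:ℝ)/4) = i ^ 3 * s := by
    rw [show i ^ 12 * s ^ 4 = (i ^ 3 * s) ^ 4 by ring, ← Real.rpow_natCast_mul (by positivity)]
    norm_num
  have h2 : (i ^ 12) ^ ((5:ℝ)/3) = i ^ 20 := by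
    rw [← Real.rpow_natCast_mul hi, ← Real.rpow_natCast]
    norm_num
  have h3 : (4:ℝ) ^ ((4:ℝ)/3) = c ^ 4 := by
    have h : (c ^ 3) ^ ((4:ℝ)/3) = c ^ 4 := by
      rw [← Real.rpow_natCast_mul hc.le, ← Real.rpow_natCast]
      norm_num
    rwa [hc3] at h
  rw [h1, h2, h3]
  obtain ⟨r, rfl⟩ : ∃ r, s = r / c := ⟨s * c, by field_simp⟩
  have amgm : 4 * (i ^ 5) ^ 3 * r ≤ r ^ 4 + 3 * (i ^ 5) ^ 4 := by
    nlinarith [mul_nonneg (sq_nonneg (r - i ^ 5))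
      (add_nonneg (sq_nonneg (r + i ^ 5)) (mul_nonneg zero_le_two (sq_nonneg (i ^ 5))))]
  have hmul : i ^ 3 * (r / c) * i ^ 12 = 4 * (i ^ 5) ^ 3 * r / c ^ 4 := by
    rw [← hc3]; field_simp
  rw [hmul, div_pow, ← sub_div, div_mul_eq_mul_div]
  gcongr
  linarith

/-- Instantaneous bound on the enstrophy rate of change for the viscous Burgers
equation on the unit circle: `R(u) ≤ (3/4^{4/3}) (∫ u'²)^{5/3} = (3/2) E(u)^{5/3}`. -/
theorem rate_le_enstrophy_pow (u : ℝ → ℝ)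
    (hu : ContDiff ℝ 2 u)
    (hper : ∀ x : ℝ, u (x + 1) = u x) :
    (-∫ x in (-(1:ℝ)/2)..(1/2), ((deriv (deriv u) x) ^ 2 + (deriv u x) ^ 3)) ≤
        (3 / 4 ^ ((4:ℝ)/3)) * (∫ x in (-(1:ℝ)/2)..(1/2), (deriv u x) ^ 2) ^ ((5:ℝ)/3) ∧
    (-∫ x in (-(1:ℝ)/2)..(1/2), ((deriv (deriv u) x) ^ 2 + (deriv u x) ^ 3)) ≤
        (3/2) * ((1/2) * ∫ x in (-(1:ℝ)/2)..(1/2), (deriv u x) ^ 2) ^ ((5:ℝ)/3) := by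
  set I := ∫ x in (-(1:ℝ)/2)..(1/2), (deriv u x) ^ 2 with hIdef
  set D := ∫ x in (-(1:ℝ)/2)..(1/2), (deriv (deriv u) x) ^ 2 with hDdef
  have hle : -(1:ℝ)/2 ≤ 1/2 := by norm_num
  have hI : 0 ≤ I := intervalIntegral.integral_nonneg hle fun x _ ↦ sq_nonneg _
  have hD : 0 ≤ D := intervalIntegral.integral_nonneg hle fun x _ ↦ sq_nonneg _
  have hv : ContDiff ℝ 1 (deriv u) := hu.deriv'
  have hv' : Continuous (deriv (deriv u)) := hv.continuous_deriv le_rfl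
  have hvc : Continuous (deriv u) := hv.continuous
  set m := (I * D) ^ ((1:ℝ)/4) with hm
  have hbound (x : ℝ) : |deriv u x| ≤ m := by
    have hm4 : m ^ 4 = I * D := by
      rw [hm, ← Real.rpow_mul_natCast (by positivity)]
      norm_num
    refine le_of_pow_le_pow_left₀ four_ne_zero (by positivity) ?_
    rw [hm4, Even.pow_abs (by decide)]
    exact deriv_pow_four_le hu hper x
  have hcube : -∫ x in (-(1:ℝ)/2)..(1/2), deriv u x ^ 3 ≤ m * I := by
    rw [← intervalIntegral.integral_neg, hIdef, ← intervalIntegral.integral_const_mul]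
    refine intervalIntegral.integral_mono_on hle
      (Continuous.intervalIntegrable (by fun_prop) _ _)
      (Continuous.intervalIntegrable (by fun_prop) _ _) fun x _ ↦ ?_
    calc -deriv u x ^ 3 = -deriv u x * deriv u x ^ 2 := by ring
      _ ≤ m * deriv u x ^ 2 := by
        gcongr
        exact (neg_le_abs _).trans (hbound x)
  have hrate : -∫ x in (-(1:ℝ)/2)..(1/2), ((deriv (deriv u) x) ^ 2 + (deriv u x) ^ 3) ≤
      3 / 4 ^ ((4:ℝ)/3) * I ^ ((5:ℝ)/3) := by
    rw [integral_add (Continuous.intervalIntegrable (by fun_prop) _ _)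
      (Continuous.intervalIntegrable (by fun_prop) _ _)]
    linarith [rpow_mul_sub_le hI hD]
  have hconst : 3 / 2 * (1 / 2 * I) ^ ((5:ℝ)/3) = 3 / 4 ^ ((4:ℝ)/3) * I ^ ((5:ℝ)/3) := by
    have h4 : (4:ℝ) ^ ((4:ℝ)/3) = 2 * 2 ^ ((5:ℝ)/3) := by
      rw [show (4:ℝ) = 2 ^ (2:ℝ) by norm_num, ← Real.rpow_mul zero_le_two,
        ← Real.rpow_one_add' zero_le_two (by norm_num)]
      norm_num
    rw [Real.mul_rpow (by norm_num) hI, Real.div_rpow zero_le_one zero_le_two, Real.one_rpow, h4]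
    field_simp
  exact ⟨hrate, hconst ▸ hrate⟩
end

section
/- Let T > 0 and let u : ℝ × [0,T] → ℝ be 1-periodic in x, three times continuously differentiable in x and once in t, satisfy the viscous Burgers equation ∂_t u + 2u ∂_x u = ∂_x² u, and assume the initial data u₀ := u(·,0) has zero mean, ∫_{-1/2}^{1/2} u₀(x) dx = 0, and E(u₀) > 0. Then the enstrophy satisfies E(u(·,T)) ≤ ( E(u₀)^{1/3} + E(u₀)/(16π²) )³, where E(u(·,t)) = (1/2)∫_{-1/2}^{1/2} (∂_x u(x,t))² dx. -/
open MeasureTheory intervalIntegral Set Real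
open Filter Topology

/-- The unnormalised heat evolution of `g`: up to the factor `√π`, the convolution of `g` with the
heat kernel at time `t`. -/
noncomputable def heatEvolution (g : ℝ → ℝ) (x t : ℝ) : ℝ :=
  ∫ z : ℝ, g (x + 2 * √t * z) * rexp (-1 * z ^ 2)

lemma integrable_bounded_mul_gaussian {f : ℝ → ℝ} (hf : Continuous f) {C : ℝ}
    (hC : ∀ x, |f x| ≤ C) : Integrable fun z : ℝ => f z * rexp (-1 * z ^ 2) := by
  refine (integrable_exp_neg_mul_sq one_pos).bdd_mul (c := C) hf.aestronglyMeasurable ?_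
  exact Eventually.of_forall fun z => hC z

lemma integrable_bounded_mul_id_mul_gaussian {f : ℝ → ℝ} (hf : Continuous f) {C : ℝ}
    (hC : ∀ x, |f x| ≤ C) : Integrable fun z : ℝ => f z * (z * rexp (-1 * z ^ 2)) := by
  refine (integrable_mul_exp_neg_mul_sq one_pos).bdd_mul (c := C) hf.aestronglyMeasurable ?_
  exact Eventually.of_forall fun z => hC z

lemma continuous_heatEvolution {g : ℝ → ℝ} (hg : Continuous g) {C : ℝ} (hC : ∀ x, |g x| ≤ C) :
    Continuous fun p : ℝ × ℝ => heatEvolution g p.1 p.2 := by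
  unfold heatEvolution
  refine MeasureTheory.continuous_of_dominated (bound := fun z => C * rexp (-1 * z ^ 2)) ?_ ?_ ?_ ?_
  · intro p
    exact (by fun_prop : Continuous _).aestronglyMeasurable
  · intro p
    refine Eventually.of_forall fun z => ?_
    rw [norm_mul, Real.norm_eq_abs, Real.norm_eq_abs, abs_exp]
    gcongr
    exact hC _
  · exact (integrable_exp_neg_mul_sq one_pos).const_mul C
  · exact Eventually.of_forall fun z => by fun_prop

lemma heatEvolution_zero (g : ℝ → ℝ) (x : ℝ) : heatEvolution g x 0 = g x * √π := by
  simp only [heatEvolution, Real.sqrt_zero, mul_zero, zero_mul, add_zero]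
  rw [MeasureTheory.integral_const_mul, integral_gaussian, div_one]

lemma heatEvolution_periodic {g : ℝ → ℝ} (hg : Function.Periodic g 1) (x t : ℝ) :
    heatEvolution g (x + 1) t = heatEvolution g x t := by
  unfold heatEvolution
  congr 1
  ext z
  rw [show x + 1 + 2 * √t * z = (x + 2 * √t * z) + 1 by ring, hg]

lemma heatEvolution_pos {g : ℝ → ℝ} (hg : Continuous g) {C : ℝ} (hC : ∀ x, |g x| ≤ C)
    (hpos : ∀ x, 0 < g x) (x t : ℝ) : 0 < heatEvolution g x t := by
  refine MeasureTheory.integral_pos_of_integrable_nonneg_nonzero (x := 0) (by fun_prop)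
    (integrable_bounded_mul_gaussian (by fun_prop) fun z => hC _)
    (fun z => (mul_pos (hpos _) (exp_pos _)).le) (mul_pos (hpos _) (exp_pos _)).ne'

lemma hasDerivAt_heatEvolution_space {g g' : ℝ → ℝ} (hg : ∀ x, HasDerivAt g (g' x) x)
    (hg' : Continuous g') {C C' : ℝ} (hC : ∀ x, |g x| ≤ C) (hC' : ∀ x, |g' x| ≤ C') (x t : ℝ) :
    HasDerivAt (fun y => heatEvolution g y t) (heatEvolution g' x t) x := by
  have hgc : Continuous g := continuous_iff_continuousAt.2 fun x => (hg x).continuousAt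
  unfold heatEvolution
  refine (_root_.hasDerivAt_integral_of_dominated_loc_of_deriv_le
    (F := fun y z => g (y + 2 * √t * z) * rexp (-1 * z ^ 2))
    (F' := fun y z => g' (y + 2 * √t * z) * rexp (-1 * z ^ 2))
    (bound := fun z => C' * rexp (-1 * z ^ 2)) (s := univ) univ_mem ?_ ?_ ?_ ?_ ?_ ?_).2
  · exact Eventually.of_forall fun y => (by fun_prop : Continuous _).aestronglyMeasurable
  · exact integrable_bounded_mul_gaussian (by fun_prop) fun z => hC _
  · exact (by fun_prop : Continuous _).aestronglyMeasurable
  · refine Eventually.of_forall fun z y _ => ?_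
    rw [norm_mul, Real.norm_eq_abs, Real.norm_eq_abs, abs_exp]
    gcongr
    exact hC' _
  · exact (integrable_exp_neg_mul_sq one_pos).const_mul C'
  · refine Eventually.of_forall fun z y _ => ?_
    exact ((hg _).comp_add_const y _).mul_const _

lemma integral_mul_id_mul_gaussian {f f' : ℝ → ℝ} (hf : ∀ x, HasDerivAt f (f' x) x)
    (hf' : Continuous f') {C C' : ℝ} (hC : ∀ x, |f x| ≤ C) (hC' : ∀ x, |f' x| ≤ C') :
    ∫ z : ℝ, f z * (z * rexp (-1 * z ^ 2)) = (∫ z : ℝ, f' z * rexp (-1 * z ^ 2)) / 2 := by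
  have hfc : Continuous f := continuous_iff_continuousAt.2 fun x => (hf x).continuousAt
  have hw : ∀ z : ℝ, HasDerivAt (fun z => -rexp (-1 * z ^ 2) / 2) (z * rexp (-1 * z ^ 2)) z := by
    intro z
    have := (((hasDerivAt_pow 2 z).const_mul (-1)).exp.neg).div_const 2
    refine this.congr_deriv ?_
    push_cast
    ring
  have h := integral_mul_deriv_eq_deriv_mul_of_integrable (u := f) (u' := f')
    (v := fun z : ℝ => -rexp (-1 * z ^ 2) / 2) (v' := fun z : ℝ => z * rexp (-1 * z ^ 2))
    (fun x _ => hf x) (fun x _ => hw x)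
    (integrable_bounded_mul_id_mul_gaussian hfc hC)
    (((integrable_bounded_mul_gaussian hf' hC').div_const (-2)).congr
      (Eventually.of_forall fun z => by simp only [Pi.mul_apply]; ring))
    (((integrable_bounded_mul_gaussian hfc hC).div_const (-2)).congr
      (Eventually.of_forall fun z => by simp only [Pi.mul_apply]; ring))
  rw [h, ← MeasureTheory.integral_neg, ← MeasureTheory.integral_div]
  congr 1
  ext z
  ring

lemma hasDerivAt_heatEvolution_time {g g' g'' : ℝ → ℝ} (hg : ∀ x, HasDerivAt g (g' x) x)
    (hg' : ∀ x, HasDerivAt g' (g'' x) x) (hg'' : Continuous g'') {C C' C'' : ℝ}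
    (hC : ∀ x, |g x| ≤ C) (hC' : ∀ x, |g' x| ≤ C') (hC'' : ∀ x, |g'' x| ≤ C'')
    (x : ℝ) {t : ℝ} (ht : 0 < t) :
    HasDerivAt (fun s => heatEvolution g x s) (heatEvolution g'' x t) t := by
  have hgc : Continuous g := continuous_iff_continuousAt.2 fun x => (hg x).continuousAt
  have hgc' : Continuous g' := continuous_iff_continuousAt.2 fun x => (hg' x).continuousAt
  have hdil : ∀ σ : ℝ, HasDerivAt (fun σ => ∫ z : ℝ, g (x + σ * z) * rexp (-1 * z ^ 2))
      (∫ z : ℝ, g' (x + σ * z) * (z * rexp (-1 * z ^ 2))) σ := by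
    intro σ
    refine (_root_.hasDerivAt_integral_of_dominated_loc_of_deriv_le
      (F := fun σ z => g (x + σ * z) * rexp (-1 * z ^ 2))
      (F' := fun σ z => g' (x + σ * z) * (z * rexp (-1 * z ^ 2)))
      (bound := fun z => C' * |z * rexp (-1 * z ^ 2)|) (s := univ) univ_mem ?_ ?_ ?_ ?_ ?_ ?_).2
    · exact Eventually.of_forall fun y => (by fun_prop : Continuous _).aestronglyMeasurable
    · exact integrable_bounded_mul_gaussian (by fun_prop) fun z => hC _
    · exact (by fun_prop : Continuous _).aestronglyMeasurable
    · refine Eventually.of_forall fun z y _ => ?_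
      rw [norm_mul, Real.norm_eq_abs, Real.norm_eq_abs]
      gcongr
      exact hC' _
    · exact (integrable_mul_exp_neg_mul_sq one_pos).abs.const_mul C'
    · refine Eventually.of_forall fun z y _ => ?_
      have h1 : HasDerivAt (fun y => x + y * z) z y := by
        simpa using ((hasDerivAt_id y).mul_const z).const_add x
      have := ((hg (x + y * z)).comp y h1).mul_const (rexp (-1 * z ^ 2))
      rwa [mul_assoc] at this
  have hs : HasDerivAt (fun s => 2 * √s) (1 / √t) t := by
    have := (Real.hasDerivAt_sqrt ht.ne').const_mul 2
    refine this.congr_deriv ?_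
    field_simp
  have h := (hdil (2 * √t)).comp t hs
  have hst := integral_mul_id_mul_gaussian
    (f := fun z => g' (x + 2 * √t * z)) (f' := fun z => 2 * √t * g'' (x + 2 * √t * z))
    (fun z => by
      have h1 : HasDerivAt (fun z => x + 2 * √t * z) (2 * √t) z := by
        simpa using ((hasDerivAt_id z).const_mul (2 * √t)).const_add x
      have := (hg' (x + 2 * √t * z)).comp z h1
      exact this.congr_deriv (mul_comm _ _))
    (by fun_prop) (C := C') (C' := 2 * √t * C'') (fun z => hC' _)
    (fun z => by
      rw [abs_mul, abs_of_nonneg (by positivity : 0 ≤ 2 * √t)]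
      gcongr
      exact hC'' _)
  rw [hst] at h
  refine h.congr_deriv ?_
  simp only [mul_assoc (2 * √t) (g'' _), MeasureTheory.integral_const_mul, heatEvolution]
  field_simp

/-- A classical `1`-periodic solution `v` of the Burgers equation for positive times, with
`a = ∂ₓv`, `b = ∂ₓ²v` and `c = ∂ₓ³v`, all of them continuous up to the initial time. -/
structure IsBurgersJet (v a b c : ℝ → ℝ → ℝ) : Prop where
  continuous_v : Continuous fun p : ℝ × ℝ => v p.1 p.2
  continuous_a : Continuous fun p : ℝ × ℝ => a p.1 p.2
  continuous_b : Continuous fun p : ℝ × ℝ => b p.1 p.2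
  continuous_c : Continuous fun p : ℝ × ℝ => c p.1 p.2
  periodic_v : ∀ x t, v (x + 1) t = v x t
  periodic_a : ∀ x t, a (x + 1) t = a x t
  periodic_b : ∀ x t, b (x + 1) t = b x t
  space_v : ∀ x t, HasDerivAt (fun y => v y t) (a x t) x
  space_a : ∀ x t, HasDerivAt (fun y => a y t) (b x t) x
  space_b : ∀ x t, HasDerivAt (fun y => b y t) (c x t) x
  time_v : ∀ x t, 0 < t → HasDerivAt (fun s => v x s) (b x t - 2 * v x t * a x t) t
  time_a : ∀ x t, 0 < t →
    HasDerivAt (fun s => a x s) (c x t - 2 * a x t ^ 2 - 2 * v x t * b x t) t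

lemma periodic_deriv {g g' : ℝ → ℝ} (hg : Function.Periodic g 1)
    (hd : ∀ x, HasDerivAt g (g' x) x) : Function.Periodic g' 1 := by
  intro x
  have h := (hd (x + 1)).comp_add_const x 1
  rw [show (fun x => g (x + 1)) = g from funext hg] at h
  exact h.unique (hd x)

lemma exists_bound_of_periodic {g : ℝ → ℝ} (hg : Continuous g) (hp : Function.Periodic g 1) :
    ∃ C, ∀ x, |g x| ≤ C := by
  obtain ⟨C, hC⟩ := (hp.compact_of_continuous one_ne_zero hg).isBounded.exists_norm_le
  exact ⟨C, fun x => hC _ (mem_range_self x)⟩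

/-- The Cole–Hopf transform of the heat evolution of a positive periodic function. -/
lemma exists_burgersJet_of_potential {g₀ g₁ g₂ g₃ g₄ : ℝ → ℝ} (hpos : ∀ x, 0 < g₀ x)
    (hper : Function.Periodic g₀ 1) (h₀ : ∀ x, HasDerivAt g₀ (g₁ x) x)
    (h₁ : ∀ x, HasDerivAt g₁ (g₂ x) x) (h₂ : ∀ x, HasDerivAt g₂ (g₃ x) x)
    (h₃ : ∀ x, HasDerivAt g₃ (g₄ x) x) (h₄ : Continuous g₄) :
    ∃ v a b c, IsBurgersJet v a b c ∧ ∀ x, v x 0 = -(g₁ x / g₀ x) := by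
  have c₀ : Continuous g₀ := continuous_iff_continuousAt.2 fun x => (h₀ x).continuousAt
  have c₁ : Continuous g₁ := continuous_iff_continuousAt.2 fun x => (h₁ x).continuousAt
  have c₂ : Continuous g₂ := continuous_iff_continuousAt.2 fun x => (h₂ x).continuousAt
  have c₃ : Continuous g₃ := continuous_iff_continuousAt.2 fun x => (h₃ x).continuousAt
  have r₁ := periodic_deriv hper h₀
  have r₂ := periodic_deriv r₁ h₁
  have r₃ := periodic_deriv r₂ h₂
  have r₄ := periodic_deriv r₃ h₃
  obtain ⟨C₀, b₀⟩ := exists_bound_of_periodic c₀ hper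
  obtain ⟨C₁, b₁⟩ := exists_bound_of_periodic c₁ r₁
  obtain ⟨C₂, b₂⟩ := exists_bound_of_periodic c₂ r₂
  obtain ⟨C₃, b₃⟩ := exists_bound_of_periodic c₃ r₃
  obtain ⟨C₄, b₄⟩ := exists_bound_of_periodic h₄ r₄
  have hp : ∀ x t, heatEvolution g₀ x t ≠ 0 := fun x t => (heatEvolution_pos c₀ b₀ hpos x t).ne'
  have k₀ := continuous_heatEvolution c₀ b₀
  have k₁ := continuous_heatEvolution c₁ b₁
  have k₂ := continuous_heatEvolution c₂ b₂
  have k₃ := continuous_heatEvolution c₃ b₃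
  have k₄ := continuous_heatEvolution h₄ b₄
  have x₀ := hasDerivAt_heatEvolution_space h₀ c₁ b₀ b₁
  have x₁ := hasDerivAt_heatEvolution_space h₁ c₂ b₁ b₂
  have x₂ := hasDerivAt_heatEvolution_space h₂ c₃ b₂ b₃
  have x₃ := hasDerivAt_heatEvolution_space h₃ h₄ b₃ b₄
  have t₀ := fun x (t : ℝ) (ht : 0 < t) => hasDerivAt_heatEvolution_time h₀ h₁ c₂ b₀ b₁ b₂ x ht
  have t₁ := fun x (t : ℝ) (ht : 0 < t) => hasDerivAt_heatEvolution_time h₁ h₂ c₃ b₁ b₂ b₃ x ht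
  have t₂ := fun x (t : ℝ) (ht : 0 < t) => hasDerivAt_heatEvolution_time h₂ h₃ h₄ b₂ b₃ b₄ x ht
  have s₀ := heatEvolution_periodic hper
  have s₁ := heatEvolution_periodic r₁
  have s₂ := heatEvolution_periodic r₂
  have s₃ := heatEvolution_periodic r₃
  have z₀ := heatEvolution_zero g₀
  have z₁ := heatEvolution_zero g₁
  generalize heatEvolution g₀ = p₀ at *
  generalize heatEvolution g₁ = p₁ at *
  generalize heatEvolution g₂ = p₂ at *
  generalize heatEvolution g₃ = p₃ at *
  generalize heatEvolution g₄ = p₄ at *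
  -- the logarithmic quotients `pⱼ / p₀` satisfy a closed hierarchy
  obtain ⟨q₁, e₁⟩ : ∃ q : ℝ → ℝ → ℝ, q = fun x t => p₁ x t / p₀ x t := ⟨_, rfl⟩
  obtain ⟨q₂, e₂⟩ : ∃ q : ℝ → ℝ → ℝ, q = fun x t => p₂ x t / p₀ x t := ⟨_, rfl⟩
  obtain ⟨q₃, e₃⟩ : ∃ q : ℝ → ℝ → ℝ, q = fun x t => p₃ x t / p₀ x t := ⟨_, rfl⟩
  obtain ⟨q₄, e₄⟩ : ∃ q : ℝ → ℝ → ℝ, q = fun x t => p₄ x t / p₀ x t := ⟨_, rfl⟩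
  have l₁ : Continuous fun p : ℝ × ℝ => q₁ p.1 p.2 := by
    rw [e₁]; exact k₁.div k₀ fun p => hp _ _
  have l₂ : Continuous fun p : ℝ × ℝ => q₂ p.1 p.2 := by
    rw [e₂]; exact k₂.div k₀ fun p => hp _ _
  have l₃ : Continuous fun p : ℝ × ℝ => q₃ p.1 p.2 := by
    rw [e₃]; exact k₃.div k₀ fun p => hp _ _
  have l₄ : Continuous fun p : ℝ × ℝ => q₄ p.1 p.2 := by
    rw [e₄]; exact k₄.div k₀ fun p => hp _ _
  have y₁ : ∀ x t, HasDerivAt (fun y => q₁ y t) (q₂ x t - q₁ x t * q₁ x t) x := by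
    intro x t
    rw [e₁, e₂]
    refine ((x₁ x t).div (x₀ x t) (hp x t)).congr_deriv ?_
    field_simp [hp x t]
  have y₂ : ∀ x t, HasDerivAt (fun y => q₂ y t) (q₃ x t - q₂ x t * q₁ x t) x := by
    intro x t
    rw [e₁, e₂, e₃]
    refine ((x₂ x t).div (x₀ x t) (hp x t)).congr_deriv ?_
    field_simp [hp x t]
  have y₃ : ∀ x t, HasDerivAt (fun y => q₃ y t) (q₄ x t - q₃ x t * q₁ x t) x := by
    intro x t
    rw [e₁, e₃, e₄]
    refine ((x₃ x t).div (x₀ x t) (hp x t)).congr_deriv ?_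
    field_simp [hp x t]
  have w₁ : ∀ x t, 0 < t → HasDerivAt (fun s => q₁ x s) (q₃ x t - q₁ x t * q₂ x t) t := by
    intro x t ht
    rw [e₁, e₂, e₃]
    refine ((t₁ x t ht).div (t₀ x t ht) (hp x t)).congr_deriv ?_
    field_simp [hp x t]
  have w₂ : ∀ x t, 0 < t → HasDerivAt (fun s => q₂ x s) (q₄ x t - q₂ x t * q₂ x t) t := by
    intro x t ht
    rw [e₂, e₄]
    refine ((t₂ x t ht).div (t₀ x t ht) (hp x t)).congr_deriv ?_
    field_simp [hp x t]
  have m₁ : ∀ x t, q₁ (x + 1) t = q₁ x t := by simp [e₁, s₀, s₁]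
  have m₂ : ∀ x t, q₂ (x + 1) t = q₂ x t := by simp [e₂, s₀, s₂]
  have m₃ : ∀ x t, q₃ (x + 1) t = q₃ x t := by simp [e₃, s₀, s₃]
  refine ⟨fun x t => -q₁ x t, fun x t => -q₂ x t + q₁ x t ^ 2,
    fun x t => -q₃ x t + 3 * (q₁ x t * q₂ x t) - 2 * q₁ x t ^ 3,
    fun x t => -q₄ x t + 4 * (q₁ x t * q₃ x t) + 3 * q₂ x t ^ 2 - 12 * (q₁ x t ^ 2 * q₂ x t)
      + 6 * q₁ x t ^ 4, ⟨?_, ?_, ?_, ?_, ?_, ?_, ?_, ?_, ?_, ?_, ?_, ?_⟩, ?_⟩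
  · fun_prop
  · fun_prop
  · fun_prop
  · fun_prop
  · simp [m₁]
  · simp [m₁, m₂]
  · simp [m₁, m₂, m₃]
  · intro x t
    exact (y₁ x t).neg.congr_deriv (by ring)
  · intro x t
    exact ((y₂ x t).neg.add ((y₁ x t).pow 2)).congr_deriv (by push_cast; ring)
  · intro x t
    exact (((y₃ x t).neg.add (((y₁ x t).mul (y₂ x t)).const_mul 3)).sub
      (((y₁ x t).pow 3).const_mul 2)).congr_deriv (by push_cast; ring)
  · intro x t ht
    exact (w₁ x t ht).neg.congr_deriv (by ring)
  · intro x t ht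
    exact ((w₂ x t ht).neg.add ((w₁ x t ht).pow 2)).congr_deriv (by push_cast; ring)
  · intro x
    have : √π ≠ 0 := by positivity
    simp only [e₁, z₀, z₁]
    rw [mul_div_mul_right _ _ this]

/-- Existence for the periodic Burgers equation with `C³` mean-zero initial data. -/
lemma exists_burgersJet {f : ℝ → ℝ} (hf : ContDiff ℝ 3 f) (hper : Function.Periodic f 1)
    (hmean : ∫ x in (-(1:ℝ)/2)..(1/2), f x = 0) :
    ∃ v a b c, IsBurgersJet v a b c ∧ ∀ x, v x 0 = f x := by
  have d₀ : ∀ x, HasDerivAt f (deriv f x) x := fun x =>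
    (hf.differentiable (by norm_num) x).hasDerivAt
  have hf₁ : ContDiff ℝ 2 (deriv f) :=
    (contDiff_succ_iff_deriv.1
      (by simpa [show (2 : WithTop ℕ∞) + 1 = 3 by norm_num] using hf)).2.2
  have d₁ : ∀ x, HasDerivAt (deriv f) (deriv (deriv f) x) x := fun x =>
    (hf₁.differentiable (by norm_num) x).hasDerivAt
  have hf₂ : ContDiff ℝ 1 (deriv (deriv f)) :=
    (contDiff_succ_iff_deriv.1
      (by simpa [show (1 : WithTop ℕ∞) + 1 = 2 by norm_num] using hf₁)).2.2
  have d₂ : ∀ x, HasDerivAt (deriv (deriv f)) (deriv (deriv (deriv f)) x) x := fun x =>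
    (hf₂.differentiable (by norm_num) x).hasDerivAt
  have hf₃ : Continuous (deriv (deriv (deriv f))) := hf₂.continuous_deriv le_rfl
  have k₀ : Continuous f := hf.continuous
  have k₁ : Continuous (deriv f) := hf₁.continuous
  have k₂ : Continuous (deriv (deriv f)) := hf₂.continuous
  set G : ℝ → ℝ := fun x => rexp (-∫ y in (0:ℝ)..x, f y) with hG
  have hGd : ∀ x, HasDerivAt G (-f x * G x) x := fun x => by
    have := (intervalIntegral.integral_hasDerivAt_right (k₀.intervalIntegrable 0 x)
      k₀.aestronglyMeasurable.stronglyMeasurableAtFilter k₀.continuousAt).neg.exp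
    exact this.congr_deriv (mul_comm _ _)
  have hGc : Continuous G := continuous_iff_continuousAt.2 fun x => (hGd x).continuousAt
  have hGp : Function.Periodic G 1 := fun x => by
    have h1 : ∫ y in x..x + 1, f y = 0 := by
      rw [hper.intervalIntegral_add_eq x (-(1:ℝ)/2), ← hmean]
      norm_num
    simp only [hG]
    rw [← intervalIntegral.integral_add_adjacent_intervals (k₀.intervalIntegrable 0 x)
      (k₀.intervalIntegrable x (x + 1)), h1, add_zero]
  obtain ⟨v, a, b, c, hv, h0⟩ := exists_burgersJet_of_potential (g₀ := G)
    (g₁ := fun x => -f x * G x) (g₂ := fun x => (f x ^ 2 - deriv f x) * G x)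
    (g₃ := fun x => (3 * (f x * deriv f x) - deriv (deriv f) x - f x ^ 3) * G x)
    (g₄ := fun x => (3 * deriv f x ^ 2 + 4 * (f x * deriv (deriv f) x)
      - deriv (deriv (deriv f)) x - 6 * (f x ^ 2 * deriv f x) + f x ^ 4) * G x)
    (fun x => exp_pos _) hGp hGd
    (fun x => ((d₀ x).neg.mul (hGd x)).congr_deriv (by simp only [Pi.neg_apply]; ring))
    (fun x => ((((d₀ x).pow 2).sub (d₁ x)).mul (hGd x)).congr_deriv
      (by simp only [Pi.sub_apply, Pi.pow_apply]; push_cast; ring))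
    (fun x => ((((((d₀ x).mul (d₁ x)).const_mul 3).sub (d₂ x)).sub ((d₀ x).pow 3)).mul
      (hGd x)).congr_deriv
        (by simp only [Pi.mul_apply, Pi.sub_apply, Pi.pow_apply]; push_cast; ring))
    (by fun_prop)
  refine ⟨v, a, b, c, hv, fun x => ?_⟩
  rw [h0, neg_mul, neg_div, neg_neg, mul_div_cancel_right₀ _ (exp_pos _).ne']

lemma IsLocalMax.deriv_deriv_nonpos {f f' : ℝ → ℝ} {f'' x : ℝ} (h : IsLocalMax f x)
    (hf : ∀ y, HasDerivAt f (f' y) y) (hf' : HasDerivAt f' f'' x) : f'' ≤ 0 := by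
  by_contra! hpos
  have e : deriv f = f' := funext fun y => (hf y).deriv
  have hmin : IsLocalMin f x := isLocalMin_of_deriv_deriv_pos (by rw [e, hf'.deriv]; exact hpos)
    h.deriv_eq_zero (hf x).continuousAt
  have hconst : f =ᶠ[𝓝 x] fun _ => f x := by
    filter_upwards [h, hmin] with y h1 h2 using le_antisymm h1 h2
  have h2 : deriv f =ᶠ[𝓝 x] fun _ => 0 := by simpa using hconst.deriv
  rw [e] at h2
  have := h2.deriv_eq
  rw [hf'.deriv, deriv_const] at this
  exact hpos.ne' this

lemma HasDerivAt.nonneg_of_le_left {f : ℝ → ℝ} {f' s t : ℝ} (hf : HasDerivAt f f' t) (hst : s < t)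
    (h : ∀ r ∈ Icc s t, f r ≤ f t) : 0 ≤ f' := by
  have hsl := (hasDerivAt_iff_tendsto_slope_left_right.1 hf).1
  refine ge_of_tendsto hsl ?_
  filter_upwards [Ioo_mem_nhdsLT hst] with r hr
  rw [slope_def_field]
  exact div_nonneg_of_nonpos (by linarith [h r ⟨hr.1.le, hr.2.le⟩]) (by linarith [hr.2])

/-- Maximum principle for linear parabolic equations `w_t = w_xx - α w_x - β w` on the circle. -/
lemma eq_zero_of_parabolic {T : ℝ} {w w₁ w₂ α β : ℝ → ℝ → ℝ} {L : ℝ}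
    (hc : Continuous fun p : ℝ × ℝ => w p.1 p.2) (hper : ∀ x t, w (x + 1) t = w x t)
    (h0 : ∀ x, w x 0 = 0)
    (hx₁ : ∀ t ∈ Ioo 0 T, ∀ x, HasDerivAt (fun y => w y t) (w₁ x t) x)
    (hx₂ : ∀ t ∈ Ioo 0 T, ∀ x, HasDerivAt (fun y => w₁ y t) (w₂ x t) x)
    (ht : ∀ t ∈ Ioo 0 T, ∀ x,
      HasDerivAt (fun s => w x s) (w₂ x t - α x t * w₁ x t - β x t * w x t) t)
    (hβ : ∀ t ∈ Ioo 0 T, ∀ x, |β x t| ≤ L) :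
    ∀ t ∈ Ioo 0 T, ∀ x, w x t = 0 := by
  intro τ hτ ξ
  by_contra hne
  set W : ℝ × ℝ → ℝ := fun p => w p.1 p.2 ^ 2 * rexp (-(2 * (L + 1)) * p.2) with hW
  have hWc : Continuous W := by fun_prop
  obtain ⟨⟨x₀, t₀⟩, hmem, hmax⟩ := (isCompact_Icc.prod isCompact_Icc :
    IsCompact (Icc (0:ℝ) 1 ×ˢ Icc (0:ℝ) τ)).exists_isMaxOn
      ⟨(0, 0), by simp [hτ.1.le]⟩ hWc.continuousOn
  have hglob : ∀ x, ∀ t ∈ Icc 0 τ, W (x, t) ≤ W (x₀, t₀) := by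
    intro x t htm
    have hp : Function.Periodic (fun x => W (x, t)) 1 := fun x => by simp only [hW, hper]
    obtain ⟨y, hy, hxy⟩ := hp.exists_mem_Ico₀ one_pos x
    rw [hxy]
    exact hmax ⟨⟨hy.1, hy.2.le⟩, htm⟩
  have hWpos : 0 < W (x₀, t₀) :=
    lt_of_lt_of_le (by positivity : 0 < W (ξ, τ)) (hglob ξ τ ⟨hτ.1.le, le_rfl⟩)
  have ht₀ : t₀ ∈ Ioo 0 T := by
    refine ⟨lt_of_le_of_ne hmem.2.1 ?_, hmem.2.2.trans_lt hτ.2⟩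
    rintro rfl
    simp [hW, h0] at hWpos
  have hw2 : 0 < w x₀ t₀ ^ 2 := pos_of_mul_pos_left hWpos (exp_pos _).le
  have hwne : w x₀ t₀ ≠ 0 := by
    intro h
    simp [h] at hw2
  -- spatial conditions at the maximum
  have hloc : IsLocalMax (fun y => w y t₀ ^ 2) x₀ := by
    refine Eventually.of_forall fun y => ?_
    have := hglob y t₀ hmem.2
    exact le_of_mul_le_mul_right this (exp_pos _)
  have hsq : ∀ y, HasDerivAt (fun y => w y t₀ ^ 2) (2 * (w y t₀ * w₁ y t₀)) y := fun y =>
    ((hx₁ t₀ ht₀ y).pow 2).congr_deriv (by push_cast; ring)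
  have hfirst : w₁ x₀ t₀ = 0 := by
    have := hloc.hasDerivAt_eq_zero (hsq x₀)
    simpa [hwne] using this
  have hsecond := hloc.deriv_deriv_nonpos hsq
    (((hx₁ t₀ ht₀ x₀).mul (hx₂ t₀ ht₀ x₀)).const_mul 2)
  rw [hfirst] at hsecond
  -- temporal condition at the maximum
  have htime : HasDerivAt (fun s => W (x₀, s)) (2 * (w x₀ t₀ * (w₂ x₀ t₀ - β x₀ t₀ * w x₀ t₀)
      - (L + 1) * w x₀ t₀ ^ 2) * rexp (-(2 * (L + 1)) * t₀)) t₀ := by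
    have h1 := (ht t₀ ht₀ x₀).pow 2
    have h2 := ((hasDerivAt_id t₀).const_mul (-(2 * (L + 1)))).exp
    refine (h1.mul h2).congr_deriv ?_
    simp only [hfirst, Pi.pow_apply, id]
    push_cast
    ring
  have h3 := htime.nonneg_of_le_left ht₀.1 fun r hr => hglob x₀ r ⟨hr.1, hr.2.trans hmem.2.2⟩
  have h4 := nonneg_of_mul_nonneg_left h3 (exp_pos _)
  have h5 := (abs_le.1 (hβ t₀ ht₀ x₀)).1
  nlinarith [mul_le_mul_of_nonneg_right h5 hw2.le]

/-- A classical solution agrees with the Cole–Hopf solution issued from the same data. -/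
lemma IsBurgersJet.eq_of_initial {v a b c u : ℝ → ℝ → ℝ} {T : ℝ} (hT : 0 < T)
    (hv : IsBurgersJet v a b c) (hper : ∀ x t : ℝ, u (x + 1) t = u x t)
    (hx : ∀ t ∈ Icc (0:ℝ) T, ContDiff ℝ 3 (fun x => u x t))
    (hcont : Continuous fun p : ℝ × ℝ => u p.1 p.2)
    (hburgers : ∀ x : ℝ, ∀ t ∈ Ioo (0:ℝ) T,
      HasDerivAt (fun s => u x s)
        (deriv (deriv (fun y => u y t)) x - 2 * u x t * deriv (fun y => u y t) x) t)
    (h0 : ∀ x, v x 0 = u x 0) (x : ℝ) : v x T = u x T := by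
  obtain ⟨M, hM⟩ := ((isCompact_Icc.prod isCompact_Icc :
    IsCompact (Icc (0:ℝ) 1 ×ˢ Icc (0:ℝ) T))).exists_bound_of_continuousOn
      hv.continuous_a.continuousOn
  have hMg : ∀ t ∈ Ioo 0 T, ∀ x, |2 * a x t| ≤ 2 * M := by
    intro t ht x
    have hp : Function.Periodic (fun x => a x t) 1 := fun x => hv.periodic_a x t
    obtain ⟨y, hy, hxy⟩ := hp.exists_mem_Ico₀ one_pos x
    have := hM (y, t) ⟨⟨hy.1, hy.2.le⟩, ht.1.le, ht.2.le⟩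
    rw [abs_mul, abs_two, hxy]
    gcongr
    exact this
  have key := eq_zero_of_parabolic (T := T) (w := fun x t => u x t - v x t)
    (w₁ := fun x t => deriv (fun y => u y t) x - a x t)
    (w₂ := fun x t => deriv (deriv (fun y => u y t)) x - b x t)
    (α := fun x t => 2 * u x t) (β := fun x t => 2 * a x t) (L := 2 * M)
    (hcont.sub hv.continuous_v) (fun x t => by simp only [hper, hv.periodic_v])
    (fun x => by simp only [h0, sub_self])
    (fun t ht x => (((hx t ⟨ht.1.le, ht.2.le⟩).differentiable (by norm_num) x).hasDerivAt).sub
      (hv.space_v x t))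
    (fun t ht x => by
      have h3 := hx t ⟨ht.1.le, ht.2.le⟩
      rw [show (3 : WithTop ℕ∞) = 2 + 1 by norm_num] at h3
      have h2 := (contDiff_succ_iff_deriv.1 h3).2.2
      exact ((h2.differentiable (by norm_num) x).hasDerivAt).sub (hv.space_a x t))
    (fun t ht x => ((hburgers x t ht).sub (hv.time_v x t ht.1)).congr_deriv (by ring))
    hMg
  have hT' : T ∈ closure (Ioo 0 T) := by
    rw [closure_Ioo hT.ne]
    exact ⟨hT.le, le_rfl⟩
  have heq : EqOn (fun t => v x t) (fun t => u x t) (closure (Ioo 0 T)) := by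
    refine EqOn.closure (fun t ht => ?_) ?_ ?_
    · exact (sub_eq_zero.1 (key t ht x)).symm
    · exact hv.continuous_v.comp (by fun_prop : Continuous fun t : ℝ => (x, t))
    · exact hcont.comp (by fun_prop : Continuous fun t : ℝ => (x, t))
  exact heq hT'

lemma hasDerivAt_integral_time {f f' : ℝ → ℝ → ℝ} (α β : ℝ)
    (hf : Continuous fun p : ℝ × ℝ => f p.1 p.2) (hf' : Continuous fun p : ℝ × ℝ => f' p.1 p.2)
    (hd : ∀ x t, 0 < t → HasDerivAt (fun s => f x s) (f' x t) t) {t : ℝ} (ht : 0 < t) :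
    HasDerivAt (fun s => ∫ x in α..β, f x s) (∫ x in α..β, f' x t) t := by
  have hs : Icc (t / 2) (2 * t) ∈ 𝓝 t := Icc_mem_nhds (by linarith) (by linarith)
  obtain ⟨M, hM⟩ := ((isCompact_uIcc.prod isCompact_Icc :
    IsCompact (uIcc α β ×ˢ Icc (t / 2) (2 * t)))).exists_bound_of_continuousOn hf'.continuousOn
  have hfs : ∀ s, Continuous fun x => f x s := fun s =>
    hf.comp (by fun_prop : Continuous fun x : ℝ => (x, s))
  have hfs' : ∀ s, Continuous fun x => f' x s := fun s =>
    hf'.comp (by fun_prop : Continuous fun x : ℝ => (x, s))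
  refine (intervalIntegral.hasDerivAt_integral_of_dominated_loc_of_deriv_le
    (F := fun s x => f x s) (F' := fun s x => f' x s) (bound := fun _ => M) hs
    (Eventually.of_forall fun s => (hfs s).aestronglyMeasurable) ((hfs t).intervalIntegrable _ _)
    (hfs' t).aestronglyMeasurable ?_ intervalIntegrable_const ?_).2
  · exact Eventually.of_forall fun x hx s hs => hM (x, s) ⟨uIoc_subset_uIcc hx, hs⟩
  · exact Eventually.of_forall fun x _ s hs => hd x s (by linarith [hs.1])

lemma integral_deriv_eq_zero_of_periodic {f f' : ℝ → ℝ} (hd : ∀ x, HasDerivAt f (f' x) x)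
    (hf' : Continuous f') (hp : Function.Periodic f 1) :
    ∫ x in (-(1:ℝ)/2)..(1/2), f' x = 0 := by
  rw [intervalIntegral.integral_eq_sub_of_hasDerivAt (fun x _ => hd x)
    (hf'.intervalIntegrable _ _), sub_eq_zero, ← hp (-(1:ℝ)/2)]
  norm_num

/-- Weighted Agmon inequality for the derivative `a` of a periodic function. -/
lemma two_mul_sq_le_of_periodic {v a b : ℝ → ℝ} (hv : ∀ x, HasDerivAt v (a x) x)
    (ha : ∀ x, HasDerivAt a (b x) x) (hb : Continuous b) (hp : Function.Periodic v 1)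
    (l x : ℝ) :
    2 * l * a x ^ 2 ≤ l ^ 2 * (∫ y in (-(1:ℝ)/2)..(1/2), a y ^ 2)
      + ∫ y in (-(1:ℝ)/2)..(1/2), b y ^ 2 := by
  have cv : Continuous v := continuous_iff_continuousAt.2 fun x => (hv x).continuousAt
  have ca : Continuous a := continuous_iff_continuousAt.2 fun x => (ha x).continuousAt
  have pa := periodic_deriv hp hv
  have pb := periodic_deriv pa ha
  obtain ⟨x₀, -, hx₀⟩ := exists_hasDerivAt_eq_zero (f := v) (f' := a) zero_lt_one cv.continuousOn
    (by simpa using (hp 0).symm) (fun x _ => hv x)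
  obtain ⟨y, hy, hxy⟩ := pa.exists_mem_Ico one_pos x x₀
  rw [hxy]
  have hd : ∀ s, HasDerivAt (fun s => l * a s ^ 2) (2 * (l * a s) * b s) s := fun s =>
    (((ha s).pow 2).const_mul l).congr_deriv (by push_cast; ring)
  have i₁ : Continuous fun s => 2 * (l * a s) * b s := by fun_prop
  have i₂ : Continuous fun s => l ^ 2 * a s ^ 2 + b s ^ 2 := by fun_prop
  have h1 := intervalIntegral.integral_eq_sub_of_hasDerivAt (a := x₀) (b := y) (fun s _ => hd s)
    (i₁.intervalIntegrable _ _)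
  have h2 := intervalIntegral.integral_eq_sub_of_hasDerivAt (a := y) (b := x₀ + 1)
    (fun s _ => hd s) (i₁.intervalIntegrable _ _)
  have h3 : ∫ s in x₀..y, 2 * (l * a s) * b s ≤ ∫ s in x₀..y, (l ^ 2 * a s ^ 2 + b s ^ 2) :=
    intervalIntegral.integral_mono_on hy.1 (i₁.intervalIntegrable _ _)
      (i₂.intervalIntegrable _ _) fun s _ => by nlinarith [sq_nonneg (l * a s - b s)]
  have h4 : ∫ s in y..(x₀ + 1), -(2 * (l * a s) * b s)
      ≤ ∫ s in y..(x₀ + 1), (l ^ 2 * a s ^ 2 + b s ^ 2) :=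
    intervalIntegral.integral_mono_on hy.2.le (i₁.neg.intervalIntegrable _ _)
      (i₂.intervalIntegrable _ _) fun s _ => by nlinarith [sq_nonneg (l * a s + b s)]
  rw [intervalIntegral.integral_neg] at h4
  have h5 := intervalIntegral.integral_add_adjacent_intervals
    (i₂.intervalIntegrable (μ := volume) x₀ y) (i₂.intervalIntegrable y (x₀ + 1))
  have h6 : ∫ s in x₀..(x₀ + 1), (l ^ 2 * a s ^ 2 + b s ^ 2)
      = l ^ 2 * (∫ y in (-(1:ℝ)/2)..(1/2), a y ^ 2) + ∫ y in (-(1:ℝ)/2)..(1/2), b y ^ 2 := by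
    have hper : Function.Periodic (fun s => l ^ 2 * a s ^ 2 + b s ^ 2) 1 := fun s => by
      simp only [pa s, pb s]
    rw [hper.intervalIntegral_add_eq x₀ (-(1:ℝ)/2), show -(1:ℝ)/2 + 1 = 1/2 by norm_num,
      intervalIntegral.integral_add ((by fun_prop : Continuous _).intervalIntegrable _ _)
        ((by fun_prop : Continuous _).intervalIntegrable _ _),
      intervalIntegral.integral_const_mul]
  rw [pa x₀, hx₀] at h2
  rw [hx₀] at h1
  linarith

/-- The cubic term in the enstrophy balance is controlled by the palinstrophy. -/
lemma neg_integral_cube_le {v a b : ℝ → ℝ} (hv : ∀ x, HasDerivAt v (a x) x)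
    (ha : ∀ x, HasDerivAt a (b x) x) (hb : Continuous b) (hp : Function.Periodic v 1)
    {e : ℝ} (he : 0 < e) (hE : (1/2) * (∫ y in (-(1:ℝ)/2)..(1/2), a y ^ 2) ≤ e ^ 3) :
    -(∫ y in (-(1:ℝ)/2)..(1/2), b y ^ 2) - (∫ y in (-(1:ℝ)/2)..(1/2), a y ^ 3)
      ≤ 3 / 2 * e ^ 5 := by
  have ca : Continuous a := continuous_iff_continuousAt.2 fun x => (ha x).continuousAt
  have hag := two_mul_sq_le_of_periodic hv ha hb hp (e / 2)
  set A := ∫ y in (-(1:ℝ)/2)..(1/2), a y ^ 2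
  set B := ∫ y in (-(1:ℝ)/2)..(1/2), b y ^ 2
  have hB : 0 ≤ B := intervalIntegral.integral_nonneg (by norm_num) fun y _ => sq_nonneg _
  have hpt : ∀ y, -(2 * e ^ 3) * a y ^ 3 ≤ (B + 3 / 2 * e ^ 5) * a y ^ 2 := by
    intro y
    have h1 : -(2 * e ^ 3) * a y ≤ B + 3 / 2 * e ^ 5 := by
      have h2 := hag y
      have h3 : (e / 2) ^ 2 * A ≤ (e / 2) ^ 2 * (2 * e ^ 3) := by gcongr; linarith
      nlinarith [mul_nonneg he.le (sq_nonneg (a y + e ^ 2))]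
    nlinarith [mul_le_mul_of_nonneg_right h1 (sq_nonneg (a y))]
  have hint := intervalIntegral.integral_mono_on (a := -(1:ℝ)/2) (b := 1/2) (μ := volume)
    (by norm_num) ((by fun_prop : Continuous fun y => -(2 * e ^ 3) * a y ^ 3).intervalIntegrable _ _)
    ((by fun_prop : Continuous fun y => (B + 3 / 2 * e ^ 5) * a y ^ 2).intervalIntegrable _ _)
    fun y _ => hpt y
  rw [intervalIntegral.integral_const_mul, intervalIntegral.integral_const_mul] at hint
  change _ ≤ (B + 3 / 2 * e ^ 5) * A at hint
  have h4 : (B + 3 / 2 * e ^ 5) * A ≤ (B + 3 / 2 * e ^ 5) * (2 * e ^ 3) := by gcongr; linarith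
  have he3 : 0 < 2 * e ^ 3 := by positivity
  have h5 : (2 * e ^ 3) * -(∫ y in (-(1:ℝ)/2)..(1/2), a y ^ 3)
      ≤ (2 * e ^ 3) * (B + 3 / 2 * e ^ 5) := by
    linarith
  linarith [le_of_mul_le_mul_left h5 he3]

/-- The a priori estimate: `E^{1/3} + K/4` does not increase, with a regularisation that allows the
enstrophy to vanish. -/
lemma IsBurgersJet.regularized_enstrophy_le {v a b c : ℝ → ℝ → ℝ} (h : IsBurgersJet v a b c)
    {T ε : ℝ} (hT : 0 ≤ T) (hε : 0 < ε) :
    ((1/2) * (∫ x in (-(1:ℝ)/2)..(1/2), a x T ^ 2) + ε) ^ ((1:ℝ)/3) ≤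
      ((1/2) * (∫ x in (-(1:ℝ)/2)..(1/2), a x 0 ^ 2) + ε) ^ ((1:ℝ)/3) +
        (1/8) * (∫ x in (-(1:ℝ)/2)..(1/2), v x 0 ^ 2) + ε / 2 * T := by
  have cv := h.continuous_v
  have ca := h.continuous_a
  have cb := h.continuous_b
  have cc := h.continuous_c
  have slice : ∀ {f : ℝ → ℝ → ℝ}, (Continuous fun p : ℝ × ℝ => f p.1 p.2) →
      ∀ t, Continuous fun x => f x t := fun hf t =>
    hf.comp (by fun_prop : Continuous fun x : ℝ => (x, t))
  set E : ℝ → ℝ := fun t => (1/2) * ∫ x in (-(1:ℝ)/2)..(1/2), a x t ^ 2 with hEdef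
  set K : ℝ → ℝ := fun t => (1/2) * ∫ x in (-(1:ℝ)/2)..(1/2), v x t ^ 2 with hKdef
  have hEnn : ∀ t, 0 ≤ E t := fun t => mul_nonneg (by norm_num)
    (intervalIntegral.integral_nonneg (by norm_num) fun y _ => sq_nonneg _)
  have hKnn : ∀ t, 0 ≤ K t := fun t => mul_nonneg (by norm_num)
    (intervalIntegral.integral_nonneg (by norm_num) fun y _ => sq_nonneg _)
  have hEc : Continuous E := continuous_const.mul
    (intervalIntegral.continuous_parametric_intervalIntegral_of_continuous'
      (f := fun t x => a x t ^ 2) ((ca.comp continuous_swap).fun_pow 2) _ _)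
  have hKc : Continuous K := continuous_const.mul
    (intervalIntegral.continuous_parametric_intervalIntegral_of_continuous'
      (f := fun t x => v x t ^ 2) ((cv.comp continuous_swap).fun_pow 2) _ _)
  -- enstrophy and energy balances
  have hEd : ∀ t, 0 < t → HasDerivAt E (-(∫ x in (-(1:ℝ)/2)..(1/2), b x t ^ 2)
      - ∫ x in (-(1:ℝ)/2)..(1/2), a x t ^ 3) t := by
    intro t ht
    have sv := slice cv t
    have sa := slice ca t
    have sb := slice cb t
    have sc := slice cc t
    have h1 := (hasDerivAt_integral_time (f := fun x t => a x t ^ 2)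
      (f' := fun x t => 2 * a x t * (c x t - 2 * a x t ^ 2 - 2 * v x t * b x t))
      (-(1:ℝ)/2) (1/2) (by fun_prop) (by fun_prop)
      (fun x t ht => ((h.time_a x t ht).pow 2).congr_deriv (by push_cast; ring)) ht).const_mul (1/2)
    refine h1.congr_deriv ?_
    have h2 := integral_deriv_eq_zero_of_periodic
      (f := fun x => a x t * b x t - v x t * a x t ^ 2)
      (f' := fun x => (1/2) * (2 * a x t * (c x t - 2 * a x t ^ 2 - 2 * v x t * b x t))
        + (b x t ^ 2 + a x t ^ 3))
      (fun x => (((h.space_a x t).mul (h.space_b x t)).sub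
        ((h.space_v x t).mul ((h.space_a x t).pow 2))).congr_deriv
          (by simp only [Pi.pow_apply]; push_cast; ring))
      (by fun_prop)
      (fun x => by simp only [h.periodic_v, h.periodic_a, h.periodic_b])
    rw [intervalIntegral.integral_add ((by fun_prop : Continuous _).intervalIntegrable _ _)
        ((by fun_prop : Continuous _).intervalIntegrable _ _),
      intervalIntegral.integral_const_mul,
      intervalIntegral.integral_add ((by fun_prop : Continuous _).intervalIntegrable _ _)
        ((by fun_prop : Continuous _).intervalIntegrable _ _)] at h2
    linarith
  have hKd : ∀ t, 0 < t → HasDerivAt K (-(2 * E t)) t := by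
    intro t ht
    have sv := slice cv t
    have sa := slice ca t
    have sb := slice cb t
    have h1 := (hasDerivAt_integral_time (f := fun x t => v x t ^ 2)
      (f' := fun x t => 2 * v x t * (b x t - 2 * v x t * a x t))
      (-(1:ℝ)/2) (1/2) (by fun_prop) (by fun_prop)
      (fun x t ht => ((h.time_v x t ht).pow 2).congr_deriv (by push_cast; ring)) ht).const_mul (1/2)
    refine h1.congr_deriv ?_
    have h2 := integral_deriv_eq_zero_of_periodic
      (f := fun x => v x t * a x t - 2 / 3 * v x t ^ 3)
      (f' := fun x => (1/2) * (2 * v x t * (b x t - 2 * v x t * a x t)) + a x t ^ 2)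
      (fun x => (((h.space_v x t).mul (h.space_a x t)).sub
        (((h.space_v x t).pow 3).const_mul (2 / 3))).congr_deriv (by push_cast; ring))
      (by fun_prop)
      (fun x => by simp only [h.periodic_v, h.periodic_a])
    rw [intervalIntegral.integral_add ((by fun_prop : Continuous _).intervalIntegrable _ _)
        ((by fun_prop : Continuous _).intervalIntegrable _ _),
      intervalIntegral.integral_const_mul] at h2
    simp only [hEdef]
    linarith
  -- the Lyapunov functional
  set Φ : ℝ → ℝ := fun t => (E t + ε) ^ ((1:ℝ)/3) + 1 / 4 * K t - ε / 2 * t with hΦ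
  have hΦc : Continuous Φ := by
    have : Continuous fun t => (E t + ε) ^ ((1:ℝ)/3) :=
      (hEc.add continuous_const).rpow_const fun t => Or.inr (by norm_num)
    fun_prop
  have hΦd : ∀ t, 0 < t → ∃ d ≤ 0, HasDerivAt Φ d t := by
    intro t ht
    have hpos : 0 < E t + ε := by linarith [hEnn t]
    obtain ⟨e, he⟩ : ∃ e : ℝ, e = (E t + ε) ^ ((1:ℝ)/3) := ⟨_, rfl⟩
    have he0 : 0 < e := he ▸ rpow_pos_of_pos hpos _
    have he3 : e ^ 3 = E t + ε := by
      rw [he, ← rpow_natCast, ← rpow_mul hpos.le]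
      norm_num
    have hr : (E t + ε) ^ ((1:ℝ)/3 - 1) = 1 / e ^ 2 := by
      rw [one_div (e ^ 2), he, ← rpow_natCast, ← rpow_mul hpos.le, ← rpow_neg hpos.le]
      norm_num
    have hcub := neg_integral_cube_le (fun x => h.space_v x t) (fun x => h.space_a x t)
      (slice cb t) (fun x => h.periodic_v x t) he0 (by linarith [he3] : E t ≤ e ^ 3)
    have hd := (((((hEd t ht).add_const ε).rpow_const (p := (1:ℝ)/3) (Or.inl hpos.ne')).add
      ((hKd t ht).const_mul (1/4))).sub ((hasDerivAt_id t).const_mul (ε / 2)))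
    refine ⟨_, ?_, hd⟩
    rw [hr]
    have h6 : (-(∫ x in (-(1:ℝ)/2)..(1/2), b x t ^ 2) - ∫ x in (-(1:ℝ)/2)..(1/2), a x t ^ 3)
        * ((1:ℝ)/3) * (1 / e ^ 2) ≤ 3 / 2 * e ^ 5 * ((1:ℝ)/3) * (1 / e ^ 2) := by gcongr
    have h7 : 3 / 2 * e ^ 5 * ((1:ℝ)/3) * (1 / e ^ 2) = e ^ 3 / 2 := by
      field_simp
    linarith
  have hanti : AntitoneOn Φ (Ici 0) := by
    refine antitoneOn_of_deriv_nonpos (convex_Ici 0) hΦc.continuousOn ?_ ?_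
    · intro t ht
      rw [interior_Ici] at ht
      obtain ⟨d, -, hd⟩ := hΦd t ht
      exact hd.differentiableAt.differentiableWithinAt
    · intro t ht
      rw [interior_Ici] at ht
      obtain ⟨d, hd0, hd⟩ := hΦd t ht
      rwa [hd.deriv]
  have hfin := hanti (mem_Ici.2 le_rfl) (mem_Ici.2 hT) hT
  have hK0 : K 0 = (1/2) * ∫ x in (-(1:ℝ)/2)..(1/2), v x 0 ^ 2 := rfl
  simp only [hΦ, hK0] at hfin
  change (E T + ε) ^ ((1:ℝ)/3) ≤ (E 0 + ε) ^ ((1:ℝ)/3) + _ + _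
  linarith [hKnn T]

/-- The Poincaré–Wirtinger inequality on the unit circle, with the sharp constant. -/
lemma integral_sq_le_integral_deriv_sq {f f' : ℝ → ℝ} (hf : ∀ x, HasDerivAt f (f' x) x)
    (hf' : Continuous f') (hp : Function.Periodic f 1)
    (hmean : ∫ x in (-(1:ℝ)/2)..(1/2), f x = 0) :
    ∫ x in (-(1:ℝ)/2)..(1/2), f x ^ 2 ≤
      (∫ x in (-(1:ℝ)/2)..(1/2), f' x ^ 2) / (4 * π ^ 2) := by
  have hab : -(1:ℝ)/2 < 1/2 := by norm_num
  have hfc : Continuous f := continuous_iff_continuousAt.2 fun x => (hf x).continuousAt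
  have hL2 : ∀ g : ℝ → ℝ, Continuous g →
      MemLp (fun x => (g x : ℂ)) 2 (volume.restrict (Ioc (-(1:ℝ)/2) (1/2))) := by
    intro g hg
    obtain ⟨C, hC⟩ := (isCompact_Icc (a := -(1:ℝ)/2) (b := 1/2)).exists_bound_of_continuousOn
      hg.continuousOn
    refine MemLp.of_bound (by fun_prop : Continuous _).aestronglyMeasurable C ?_
    filter_upwards [ae_restrict_mem measurableSet_Ioc] with x hx
    simpa using hC x (Ioc_subset_Icc_self hx)
  have p₀ := hasSum_sq_fourierCoeffOn hab (hL2 f hfc)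
  have p₁ := hasSum_sq_fourierCoeffOn hab (hL2 f' hf')
  have hle : ∀ n : ℤ, ‖fourierCoeffOn hab (fun x => (f x : ℂ)) n‖ ^ 2 ≤
      ‖fourierCoeffOn hab (fun x => (f' x : ℂ)) n‖ ^ 2 / (4 * π ^ 2) := by
    intro n
    rcases eq_or_ne n 0 with rfl | hn
    · have : fourierCoeffOn hab (fun x => (f x : ℂ)) 0 = 0 := by
        rw [fourierCoeffOn_eq_integral]
        simp only [neg_zero, fourier_zero, one_smul]
        rw [intervalIntegral.integral_ofReal, hmean]
        simp
      rw [this]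
      simp
      positivity
    · have hbd : f (1/2) = f (-(1:ℝ)/2) := by
        rw [← hp (-(1:ℝ)/2)]
        norm_num
      rw [fourierCoeffOn_of_hasDerivAt hab hn (f' := fun x => (f' x : ℂ))
        (fun x _ => (hf x).ofReal_comp)
        ((by fun_prop : Continuous fun x => (f' x : ℂ)).intervalIntegrable _ _), hbd]
      have h1 : (1:ℝ) ≤ (n:ℝ) ^ 2 := by
        have : 0 < n ^ 2 := by positivity
        have : 1 ≤ n ^ 2 := this
        exact_mod_cast this
      obtain ⟨γ, hγ⟩ : ∃ γ : ℂ, γ = fourierCoeffOn hab (fun x => (f' x : ℂ)) n := ⟨_, rfl⟩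
      rw [← hγ, sub_self, mul_zero, zero_sub, norm_mul, norm_neg, norm_mul, ← Complex.ofReal_sub,
        show (1/2 - -(1:ℝ)/2) = 1 by norm_num, Complex.ofReal_one, norm_one, one_mul]
      have h2 : ‖(1:ℂ) / (-2 * π * Complex.I * n)‖ ^ 2 = 1 / (4 * π ^ 2 * (n:ℝ) ^ 2) := by
        simp only [norm_div, norm_mul, norm_neg, norm_one, Complex.norm_I, Complex.norm_real,
          Complex.norm_intCast, Complex.norm_ofNat, norm_eq_abs, div_pow, mul_pow, sq_abs]
        norm_num
      rw [mul_pow, h2, div_mul_eq_mul_div, one_mul]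
      exact div_le_div_of_nonneg_left (by positivity) (by positivity)
        (le_mul_of_one_le_right (by positivity) h1)
  have hsum := hasSum_le hle p₀ (p₁.div_const _)
  have hlen : (1/2 - -(1:ℝ)/2) = 1 := by norm_num
  rw [hlen] at hsum
  simpa only [inv_one, one_smul, Complex.norm_real, norm_eq_abs, sq_abs] using hsum

/-- Global enstrophy bound for the viscous Burgers equation on the unit circle with
mean-zero initial data: `E(u(·,T)) ≤ (E(u₀)^{1/3} + E(u₀)/(16π²))³`. -/
theorem enstrophy_global_bound (T : ℝ) (hT : 0 < T) (u : ℝ → ℝ → ℝ)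
    (hper : ∀ x t : ℝ, u (x + 1) t = u x t)
    (hx : ∀ t ∈ Set.Icc (0:ℝ) T, ContDiff ℝ 3 (fun x => u x t))
    (hcont : Continuous fun p : ℝ × ℝ => u p.1 p.2)
    (hburgers : ∀ x : ℝ, ∀ t ∈ Set.Ioo (0:ℝ) T,
      HasDerivAt (fun s => u x s)
        (deriv (deriv (fun y => u y t)) x - 2 * u x t * deriv (fun y => u y t) x) t)
    (hmean : (∫ x in (-(1:ℝ)/2)..(1/2), u x 0) = 0)
    (hE0 : 0 < (1/2) * ∫ x in (-(1:ℝ)/2)..(1/2), (deriv (fun y => u y 0) x) ^ 2) :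
    (1/2) * ∫ x in (-(1:ℝ)/2)..(1/2), (deriv (fun y => u y T) x) ^ 2 ≤
      (((1/2) * ∫ x in (-(1:ℝ)/2)..(1/2), (deriv (fun y => u y 0) x) ^ 2) ^ ((1:ℝ)/3) +
        ((1/2) * ∫ x in (-(1:ℝ)/2)..(1/2), (deriv (fun y => u y 0) x) ^ 2) / (16 * π ^ 2)) ^ 3 := by
  obtain ⟨v, a, b, c, hv, h0⟩ := exists_burgersJet (hx 0 ⟨le_rfl, hT.le⟩)
    (fun x => hper x 0) hmean
  have hvT := hv.eq_of_initial hT hper hx hcont hburgers h0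
  have e0 : (fun y => u y 0) = fun y => v y 0 := funext fun y => (h0 y).symm
  have eT : (fun y => u y T) = fun y => v y T := funext fun y => (hvT y).symm
  rw [e0] at hmean hE0 ⊢
  rw [eT]
  simp only [(hv.space_v _ _).deriv] at hE0 ⊢
  have hpoin := integral_sq_le_integral_deriv_sq (fun x => hv.space_v x 0)
    (hv.continuous_a.comp (by fun_prop : Continuous fun x : ℝ => (x, (0:ℝ))))
    (fun x => hv.periodic_v x 0) hmean
  have hreg := fun (ε : ℝ) (hε : 0 < ε) => hv.regularized_enstrophy_le hT.le hε
  set A := ∫ x in (-(1:ℝ)/2)..(1/2), a x 0 ^ 2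
  have hET : 0 ≤ (1/2) * ∫ x in (-(1:ℝ)/2)..(1/2), a x T ^ 2 := mul_nonneg (by norm_num)
    (intervalIntegral.integral_nonneg (by norm_num) fun y _ => sq_nonneg _)
  set F := (1/2) * ∫ x in (-(1:ℝ)/2)..(1/2), a x T ^ 2
  set V := ∫ x in (-(1:ℝ)/2)..(1/2), v x 0 ^ 2
  have hroot : F ^ ((1:ℝ)/3) ≤ ((1/2) * A) ^ ((1:ℝ)/3) + (1/8) * V := by
    have hc : ∀ S : ℝ, Continuous fun ε : ℝ => (S + ε) ^ ((1:ℝ)/3) := fun S =>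
      (continuous_const.add continuous_id).rpow_const fun t => Or.inr (by norm_num)
    have l1 : Tendsto (fun ε : ℝ => (F + ε) ^ ((1:ℝ)/3)) (𝓝[>] 0) (𝓝 (F ^ ((1:ℝ)/3))) := by
      have := (hc F).tendsto 0
      rw [add_zero] at this
      exact this.mono_left nhdsWithin_le_nhds
    have l2 : Tendsto (fun ε : ℝ => ((1/2) * A + ε) ^ ((1:ℝ)/3) + (1/8) * V + ε / 2 * T) (𝓝[>] 0)
        (𝓝 (((1/2) * A) ^ ((1:ℝ)/3) + (1/8) * V)) := by
      have hcc : Continuous fun ε : ℝ =>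
          ((1/2) * A + ε) ^ ((1:ℝ)/3) + (1/8) * V + ε / 2 * T :=
        ((hc ((1/2) * A)).add continuous_const).add (by fun_prop)
      have := hcc.tendsto 0
      simp only [add_zero, zero_div, zero_mul] at this
      exact this.mono_left nhdsWithin_le_nhds
    refine le_of_tendsto_of_tendsto l1 l2 ?_
    filter_upwards [self_mem_nhdsWithin] with ε hε using hreg ε hε
  have hle : F ^ ((1:ℝ)/3) ≤ ((1/2) * A) ^ ((1:ℝ)/3) + ((1/2) * A) / (16 * π ^ 2) := by
    have : (1/8) * (A / (4 * π ^ 2)) = ((1/2) * A) / (16 * π ^ 2) := by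
      field_simp
      ring
    linarith
  calc F = (F ^ ((1:ℝ)/3)) ^ 3 := by
        rw [← rpow_natCast, ← rpow_mul hET]
        norm_num
    _ ≤ _ := by gcongr
end
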